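/- For every real β > 1 and all positive integers n and k satisfying (2^k/β)·(1 + ln β) < n·(ln β)/2: if n balls are thrown independently and uniformly at random into 2^k bins, then the probability that at most 2^k/β bins are occupied is at most β^{−n/2}. -/

import Mathlib

open scoped Classical

theorem card_filter_card_image_le {α ι : Type*} [Fintype α] [DecidableEq α]
    [Fintype ι] [DecidableEq ι]
    (m : ℕ) (hm : m ≤ Fintype.card α) :
    (Finset.univ.filter (fun X : ι → α => (Finset.univ.image X).card ≤ m)).card
      ≤ (Fintype.card α).choose m * m ^ Fintype.card ι := by
  have hsub : Finset.univ.filter (fun X : ι → α => (Finset.univ.image X).card ≤ m) ⊆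
      (Finset.powersetCard m (Finset.univ : Finset α)).biUnion
        (fun S => Fintype.piFinset (fun _ : ι => S)) := by
    intro X hX
    obtain ⟨S, hS, hSc⟩ := Finset.exists_superset_card_eq (Finset.mem_filter.mp hX).2 hm
    refine Finset.mem_biUnion.mpr
      ⟨S, Finset.mem_powersetCard.mpr ⟨Finset.subset_univ _, hSc⟩, ?_⟩
    exact Fintype.mem_piFinset.mpr
      fun i => hS (Finset.mem_image_of_mem X (Finset.mem_univ i))
  refine (Finset.card_le_card hsub).trans ?_
  refine (Finset.card_biUnion_le_card_mul _ _ (m ^ Fintype.card ι) fun S hS => ?_).trans ?_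
  · simp [(Finset.mem_powersetCard.mp hS).2]
  · simp

theorem choose_mul_pow_le_exp (N m : ℕ) {y : ℝ} (hy : 0 ≤ y) :
    (N.choose m : ℝ) * y ^ m ≤ Real.exp (N * y) := by
  rcases le_or_gt m N with hm | hm
  · calc (N.choose m : ℝ) * y ^ m
        ≤ ∑ i ∈ Finset.range (N + 1), y ^ i * 1 ^ (N - i) * (N.choose i : ℝ) := by
          rw [mul_comm]
          simpa using Finset.single_le_sum
            (f := fun i => y ^ i * 1 ^ (N - i) * (N.choose i : ℝ))
            (fun i _ => by positivity) (Finset.mem_range.mpr (Nat.lt_succ_of_le hm))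
      _ = (y + 1) ^ N := (add_pow y 1 N).symm
      _ ≤ Real.exp y ^ N := by
          gcongr
          exact Real.add_one_le_exp y
      _ = Real.exp (N * y) := (Real.exp_nat_mul y N).symm
  · rw [Nat.choose_eq_zero_of_lt hm]
    simpa using (Real.exp_pos _).le

/-- For every real `β > 1` and all positive integers `n` and `k` satisfying
`(2^k/β) · (1 + ln β) < n · (ln β)/2`: if `n` balls are thrown independently and
uniformly at random into `2^k` bins (the outcome is `X : Fin n → Fin (2^k)` distributed
according to the product of `n` copies of the uniform distribution), then the
probability that at most `2^k/β` bins are occupied (the image of `X` has cardinality at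
most `2^k/β`) is at most `β ^ (-n/2)`. -/
theorem gauge_size_occupied_bins (β : ℝ) (hβ : 1 < β) (n k : ℕ) (hn : 0 < n) (hk : 0 < k)
    (h : ((2 : ℝ) ^ k / β) * (1 + Real.log β) < (n : ℝ) * Real.log β / 2) :
    ((Finset.univ.filter (fun X : Fin n → Fin (2 ^ k) =>
          ((Finset.univ.image X).card : ℝ) ≤ (2 : ℝ) ^ k / β)).card : ℝ)
        / ((2 : ℝ) ^ k) ^ n
      ≤ β ^ (-(n : ℝ) / 2) := by
  have hβ0 : 0 < β := by linarith
  have hlog : 0 < Real.log β := Real.log_pos hβ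
  set m := ⌊(2 : ℝ) ^ k / β⌋₊ with hmdef
  have hmle : (m : ℝ) ≤ (2 : ℝ) ^ k / β := Nat.floor_le (by positivity)
  have hmN : m ≤ 2 ^ k := by
    have h1 : (2 : ℝ) ^ k / β ≤ 2 ^ k := div_le_self (by positivity) hβ.le
    exact_mod_cast hmle.trans h1
  have hcount : ((Finset.univ.filter (fun X : Fin n → Fin (2 ^ k) =>
      ((Finset.univ.image X).card : ℝ) ≤ (2 : ℝ) ^ k / β)).card : ℝ)
        ≤ ((2 ^ k).choose m : ℝ) * (m : ℝ) ^ n := by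
    have hc := card_filter_card_image_le (α := Fin (2 ^ k)) (ι := Fin n) m (by simpa using hmN)
    rw [Fintype.card_fin, Fintype.card_fin] at hc
    rw [← Nat.cast_pow, ← Nat.cast_mul, Nat.cast_le]
    refine (Finset.card_le_card fun X hX => ?_).trans hc
    rw [Finset.mem_filter] at hX ⊢
    refine ⟨Finset.mem_univ _, ?_⟩
    exact Nat.le_floor hX.2
  have hchoose : ((2 ^ k).choose m : ℝ) ≤ β ^ ((n : ℝ) / 2) := by
    have h1 := choose_mul_pow_le_exp (2 ^ k) m (inv_nonneg.mpr hβ0.le)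
    rw [inv_pow, ← div_eq_mul_inv, div_le_iff₀ (by positivity)] at h1
    refine h1.trans ?_
    rw [← Real.rpow_natCast β m, Real.rpow_def_of_pos hβ0, Real.rpow_def_of_pos hβ0,
      ← Real.exp_add, Real.exp_le_exp]
    push_cast
    rw [← div_eq_mul_inv]
    nlinarith [mul_le_mul_of_nonneg_left hmle hlog.le]
  have hratio : (m : ℝ) / 2 ^ k ≤ β⁻¹ := by
    rw [div_le_iff₀ (by positivity), mul_comm, ← div_eq_mul_inv]
    exact hmle
  calc _ ≤ ((2 ^ k).choose m : ℝ) * (m : ℝ) ^ n / ((2 : ℝ) ^ k) ^ n := by gcongr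
    _ = ((2 ^ k).choose m : ℝ) * ((m : ℝ) / 2 ^ k) ^ n := by rw [div_pow, mul_div_assoc]
    _ ≤ β ^ ((n : ℝ) / 2) * β⁻¹ ^ n := by gcongr
    _ = β ^ (-(n : ℝ) / 2) := by
      rw [← Real.rpow_natCast, ← Real.rpow_neg_one, ← Real.rpow_mul hβ0.le,
        ← Real.rpow_add hβ0]
      congr 1
      ring
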